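/- Let d ≥ 1, let μ, σ, c : ℝᵈ → ℝ, let λ > 0, and let α : ℝᵈ → ℝ satisfy the Pandora's Box Gittins index equation (μ(x) − α(x))·Φ((μ(x) − α(x))/σ(x)) + σ(x)·φ((μ(x) − α(x))/σ(x)) = λ·c(x) for all x ∈ ℝᵈ. Fix x₀ ∈ ℝᵈ with σ(x₀) > 0, and suppose μ, σ, c, and α are all differentiable at x₀. Then, writing z = (μ(x₀) − α(x₀))/σ(x₀), the gradient of α at x₀ is ∇α(x₀) = ∇μ(x₀) + (φ(z)·∇σ(x₀) − λ·∇c(x₀)) / Φ(z). -/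

import Mathlib

/-- The standard normal density `φ(t) = (2π)^{-1/2} exp(−t²/2)`. -/
noncomputable def stdNormalPDF (t : ℝ) : ℝ :=
  (Real.sqrt (2 * Real.pi))⁻¹ * Real.exp (-t ^ 2 / 2)

/-- The standard normal cumulative distribution function `Φ(t) = ∫_{−∞}^t φ(s) ds`. -/
noncomputable def stdNormalCDF (t : ℝ) : ℝ :=
  ∫ s in Set.Iio t, stdNormalPDF s

lemma continuous_stdNormalPDF : Continuous stdNormalPDF := by
  unfold stdNormalPDF
  fun_prop

lemma stdNormalPDF_pos (t : ℝ) : 0 < stdNormalPDF t := by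
  unfold stdNormalPDF
  positivity

lemma integrable_stdNormalPDF : MeasureTheory.Integrable stdNormalPDF := by
  have h : stdNormalPDF = ProbabilityTheory.gaussianPDFReal 0 1 := by
    funext t
    simp [stdNormalPDF, ProbabilityTheory.gaussianPDFReal]
  exact h ▸ ProbabilityTheory.integrable_gaussianPDFReal 0 1

lemma stdNormalCDF_pos (t : ℝ) : 0 < stdNormalCDF t := by
  unfold stdNormalCDF
  rw [MeasureTheory.setIntegral_pos_iff_support_of_nonneg_ae
    (Filter.Eventually.of_forall fun s => (stdNormalPDF_pos s).le)
    integrable_stdNormalPDF.integrableOn,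
    Function.support_eq_univ fun s => (stdNormalPDF_pos s).ne']
  simp

lemma hasDerivAt_stdNormalPDF (t : ℝ) :
    HasDerivAt stdNormalPDF (-t * stdNormalPDF t) t := by
  have h : HasDerivAt (fun s : ℝ => -s ^ 2 / 2) (-t) t := by
    refine ((hasDerivAt_pow 2 t).fun_neg.div_const 2).congr_deriv ?_
    norm_num
    ring
  refine (h.exp.const_mul (Real.sqrt (2 * Real.pi))⁻¹).congr_deriv ?_
  unfold stdNormalPDF
  ring

lemma hasDerivAt_stdNormalCDF (t : ℝ) : HasDerivAt stdNormalCDF (stdNormalPDF t) t := by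
  have h : stdNormalCDF = fun s => stdNormalCDF 0 + ∫ r in (0 : ℝ)..s, stdNormalPDF r := by
    funext s
    simp only [stdNormalCDF, ← MeasureTheory.integral_Iic_eq_integral_Iio]
    rw [← intervalIntegral.integral_Iic_sub_Iic integrable_stdNormalPDF.integrableOn
      integrable_stdNormalPDF.integrableOn]
    ring
  rw [h]
  exact (continuous_stdNormalPDF.integral_hasStrictDerivAt 0 t).hasDerivAt.const_add _

/-- Gradient of the Pandora's Box Gittins index acquisition function: if `α` satisfies
`(μ(x) − α(x))·Φ((μ(x) − α(x))/σ(x)) + σ(x)·φ((μ(x) − α(x))/σ(x)) = λ·c(x)` for all `x`,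
and `μ, σ, c, α` are differentiable at `x₀` with `σ(x₀) > 0`, then, with
`z = (μ(x₀) − α(x₀))/σ(x₀)`,
`∇α(x₀) = ∇μ(x₀) + (φ(z)·∇σ(x₀) − λ·∇c(x₀)) / Φ(z)`. -/
theorem pbgi_gradient (d : ℕ) (hd : 1 ≤ d)
    (μ σ c α : EuclideanSpace ℝ (Fin d) → ℝ) (lam : ℝ) (hlam : 0 < lam)
    (heq : ∀ x, (μ x - α x) * stdNormalCDF ((μ x - α x) / σ x)
      + σ x * stdNormalPDF ((μ x - α x) / σ x) = lam * c x)
    (x₀ : EuclideanSpace ℝ (Fin d)) (hσ : 0 < σ x₀)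
    (hμd : DifferentiableAt ℝ μ x₀) (hσd : DifferentiableAt ℝ σ x₀)
    (hcd : DifferentiableAt ℝ c x₀) (hαd : DifferentiableAt ℝ α x₀) :
    fderiv ℝ α x₀ = fderiv ℝ μ x₀
      + (stdNormalCDF ((μ x₀ - α x₀) / σ x₀))⁻¹ •
        (stdNormalPDF ((μ x₀ - α x₀) / σ x₀) • fderiv ℝ σ x₀ - lam • fderiv ℝ c x₀) := by
  set z := (μ x₀ - α x₀) / σ x₀ with hz
  have hu := hμd.hasFDerivAt.sub hαd.hasFDerivAt
  obtain ⟨Z, hZ⟩ : DifferentiableAt ℝ (fun x => (μ x - α x) / σ x) x₀ :=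
    by fun_prop (disch := exact hσ.ne')
  have hL := (hu.mul ((hasDerivAt_stdNormalCDF z).comp_hasFDerivAt x₀ hZ)).add
    (hσd.hasFDerivAt.mul ((hasDerivAt_stdNormalPDF z).comp_hasFDerivAt x₀ hZ))
  have hR := hL.unique ((hcd.hasFDerivAt.const_mul lam).congr_of_eventuallyEq
    (Filter.Eventually.of_forall heq))
  have hzσ : μ x₀ - α x₀ = z * σ x₀ := by rw [hz, div_mul_cancel₀ _ hσ.ne']
  have hΦ := (stdNormalCDF_pos z).ne'
  ext v
  have hv := congrArg (fun L => L v) hR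
  simp [hzσ, mul_div_cancel_right₀ z hσ.ne'] at hv ⊢
  field_simp
  linear_combination -hv
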